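/- Let d ≥ 2 and q satisfy d ≡ 2 (mod 4) and q ≡ 3 (mod 4). Then for every set A ⊆ F_q^d, one has (as an inequality of real numbers) SQ(A) + ZR(A) ≤ |A|²/2 + |A|²/(2q) − |A|²/q^{d/2} + q^{d/2}·|A|/2 + q^{(d−2)/2}·|A|/2. -/

import Mathlib

open Finset

/-- `‖x‖ = x₁² + ⋯ + x_d²` for `x ∈ F_q^d`. -/
def normSq {d : ℕ} {F : Type} [Field F] [Fintype F] (x : Fin d → F) : F := ∑ i, x i ^ 2

/-- `SQ(A)` : the number of pairs `(x,y) ∈ A×A` with `η(‖x−y‖) = 1`,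
where `η` is the quadratic character of `F` (with `η(0) = 0`). -/
noncomputable def SQpairs {d : ℕ} {F : Type} [Field F] [Fintype F] [DecidableEq F]
    (A : Finset (Fin d → F)) : ℕ :=
  ((A ×ˢ A).filter (fun p => quadraticChar F (normSq (p.1 - p.2)) = 1)).card

/-- `ZR(A)` : the number of pairs `(x,y) ∈ A×A` with `‖x−y‖ = 0`. -/
def ZRpairs {d : ℕ} {F : Type} [Field F] [Fintype F] [DecidableEq F]
    (A : Finset (Fin d → F)) : ℕ :=
  ((A ×ˢ A).filter (fun p => normSq (p.1 - p.2) = 0)).card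

section FourierTransform

variable {F : Type} [Field F] [Fintype F]

/-- The quadratic character of `F` with complex values. -/
noncomputable def complexQuadraticChar (F : Type) [Field F] [Fintype F] [DecidableEq F] :
    MulChar F ℂ :=
  (quadraticChar F).ringHomComp (Int.castRingHom ℂ)

theorem complexQuadraticChar_apply [DecidableEq F] (a : F) :
    complexQuadraticChar F a = (quadraticChar F a : ℂ) := rfl

theorem complexQuadraticChar_isQuadratic [DecidableEq F] :
    (complexQuadraticChar F).IsQuadratic :=
  (quadraticChar_isQuadratic F).comp _

theorem complexQuadraticChar_ne_one [DecidableEq F] (hF : ringChar F ≠ 2) :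
    complexQuadraticChar F ≠ 1 :=
  (MulChar.ringHomComp_ne_one_iff (RingHom.injective_int _)).mpr (quadraticChar_ne_one hF)

theorem complexQuadraticChar_inv_apply [DecidableEq F] (a : F) :
    complexQuadraticChar F a⁻¹ = complexQuadraticChar F a := by
  rw [← MulChar.inv_apply', complexQuadraticChar_isQuadratic.inv]

theorem complexQuadraticChar_four [DecidableEq F] (hF : ringChar F ≠ 2) :
    complexQuadraticChar F 4 = 1 := by
  have h2 : (2 : F) ≠ 0 := Ring.two_ne_zero hF
  rw [complexQuadraticChar_apply, show (4 : F) = 2 ^ 2 by norm_num, quadraticChar_sq_one' h2]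
  simp

theorem sum_complexQuadraticChar_mul_addChar [DecidableEq F] (hF : ringChar F ≠ 2)
    (ψ : AddChar F ℂ) (a : F) :
    ∑ t, complexQuadraticChar F t * ψ (t * a) =
      complexQuadraticChar F a * gaussSum (complexQuadraticChar F) ψ := by
  rcases eq_or_ne a 0 with rfl | ha
  · simp only [mul_zero, AddChar.map_zero_eq_one, mul_one, MulChar.map_zero, zero_mul]
    exact MulChar.sum_eq_zero_of_ne_one (complexQuadraticChar_ne_one hF)
  · have h := gaussSum_mulShift_eq (complexQuadraticChar F) ψ (Units.mk0 a ha)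
    rw [complexQuadraticChar_isQuadratic.inv, Units.val_mk0] at h
    rw [← h, gaussSum]
    simp only [AddChar.mulShift_apply, mul_comm a]

theorem sum_addChar_mul_sq [DecidableEq F] (hF : ringChar F ≠ 2)
    {ψ : AddChar F ℂ} (hψ : ψ.IsPrimitive) {t : F} (ht : t ≠ 0) :
    ∑ x, ψ (t * x ^ 2) =
      complexQuadraticChar F t * gaussSum (complexQuadraticChar F) ψ := by
  have hfib (u : F) : (#{x : F | x ^ 2 = u} : ℂ) = complexQuadraticChar F u + 1 := by
    have h := quadraticChar_card_sqrts hF u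
    rw [complexQuadraticChar_apply]
    have h' : ((#{x : F | x ^ 2 = u} : ℤ)) = quadraticChar F u + 1 := by
      rw [← h]; congr 2; ext; simp
    exact_mod_cast congrArg (Int.cast : ℤ → ℂ) h'
  have hsum : ∑ u, ψ (t * u) = 0 := by
    have := AddChar.sum_mulShift t hψ
    simpa [ht, mul_comm] using this
  calc ∑ x, ψ (t * x ^ 2) = ∑ u, ∑ x with x ^ 2 = u, ψ (t * x ^ 2) :=
        (Finset.sum_fiberwise _ _ _).symm
    _ = ∑ u, (complexQuadraticChar F u + 1) * ψ (t * u) := by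
        refine Finset.sum_congr rfl fun u _ ↦ ?_
        rw [← hfib, ← nsmul_eq_mul]
        refine Finset.sum_eq_card_nsmul fun x hx ↦ ?_
        rw [(Finset.mem_filter.mp hx).2]
    _ = _ := by
        simp only [add_mul, one_mul, Finset.sum_add_distrib, hsum, add_zero]
        rw [← sum_complexQuadraticChar_mul_addChar hF ψ]
        simp only [mul_comm t]

theorem sum_addChar_quadratic [DecidableEq F] (hF : ringChar F ≠ 2)
    {ψ : AddChar F ℂ} (hψ : ψ.IsPrimitive) {t : F} (ht : t ≠ 0) (b : F) :
    ∑ x, ψ (t * x ^ 2 + x * b) =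
      complexQuadraticChar F t * gaussSum (complexQuadraticChar F) ψ *
        ψ (-(4 * t)⁻¹ * b ^ 2) := by
  have h2 : (2 : F) ≠ 0 := Ring.two_ne_zero hF
  rw [← sum_addChar_mul_sq hF hψ ht, Finset.sum_mul]
  refine Fintype.sum_equiv (Equiv.addRight (b / (2 * t))) _ _ fun x ↦ ?_
  rw [← AddChar.map_add_eq_mul, Equiv.coe_addRight, show (4 : F) = 2 * 2 by norm_num]
  congr 1
  field_simp
  ring

theorem AddChar.map_finset_sum_eq_prod {ι A M : Type*} [AddCommMonoid A] [CommMonoid M]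
    (ψ : AddChar A M) (s : Finset ι) (f : ι → A) : ψ (∑ i ∈ s, f i) = ∏ i ∈ s, ψ (f i) :=
  map_prod ψ.toMonoidHom (fun i ↦ Multiplicative.ofAdd (f i)) s

theorem addChar_normSq_dotProduct {d : ℕ} (ψ : AddChar F ℂ) (t : F) (m z : Fin d → F) :
    ψ (t * normSq m) * ψ (m ⬝ᵥ z) = ∏ i, ψ (t * m i ^ 2 + m i * z i) := by
  rw [← AddChar.map_add_eq_mul, normSq, dotProduct, Finset.mul_sum, ← Finset.sum_add_distrib,
    AddChar.map_finset_sum_eq_prod]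

theorem sum_addChar_normSq [DecidableEq F] (hF : ringChar F ≠ 2)
    {ψ : AddChar F ℂ} (hψ : ψ.IsPrimitive) {d : ℕ} {t : F} (ht : t ≠ 0) (z : Fin d → F) :
    ∑ m : Fin d → F, ψ (t * normSq m) * ψ (m ⬝ᵥ z) =
      (complexQuadraticChar F t * gaussSum (complexQuadraticChar F) ψ) ^ d *
        ψ (-(4 * t)⁻¹ * normSq z) := by
  simp only [addChar_normSq_dotProduct]
  have h := Finset.sum_prod_piFinset (ι := Fin d) (univ : Finset F)
    (fun i x ↦ ψ (t * x ^ 2 + x * z i))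
  rw [Fintype.piFinset_univ] at h
  rw [h]
  simp only [sum_addChar_quadratic hF hψ ht]
  rw [Finset.prod_mul_distrib, Finset.prod_const, Finset.card_univ, Fintype.card_fin, normSq,
    Finset.mul_sum, AddChar.map_finset_sum_eq_prod]

theorem sum_addChar_dotProduct [DecidableEq F] {ψ : AddChar F ℂ} (hψ : ψ.IsPrimitive) {d : ℕ}
    (z : Fin d → F) :
    ∑ m : Fin d → F, ψ (m ⬝ᵥ z) = if z = 0 then (Fintype.card F : ℂ) ^ d else 0 := by
  have h := Finset.sum_prod_piFinset (ι := Fin d) (univ : Finset F) (fun i x ↦ ψ (x * z i))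
  rw [Fintype.piFinset_univ] at h
  simp only [dotProduct, AddChar.map_finset_sum_eq_prod]
  rw [h]
  simp only [AddChar.sum_mulShift _ hψ]
  split_ifs with hz
  · simp [hz]
  · obtain ⟨i, hi⟩ := Function.ne_iff.mp hz
    exact Finset.prod_eq_zero (Finset.mem_univ i) (by simpa using hi)

/-- The involution `t ↦ -1 / (4t)`, fixing `0`. -/
def negFourInv (hF : ringChar F ≠ 2) : F ≃ F :=
  Function.Involutive.toPerm (fun t ↦ -(4 * t)⁻¹) fun t ↦ by
    have h2 : (2 : F) ≠ 0 := Ring.two_ne_zero hF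
    have h4 : (4 : F) ≠ 0 := by
      rw [show (4 : F) = 2 * 2 by norm_num]; exact mul_ne_zero h2 h2
    rcases eq_or_ne t 0 with rfl | ht
    · simp
    · field_simp

omit [Fintype F] in
theorem negFourInv_apply (hF : ringChar F ≠ 2) (t : F) : negFourInv hF t = -(4 * t)⁻¹ := rfl

theorem complexQuadraticChar_negFourInv [DecidableEq F] (hF : ringChar F ≠ 2) (t : F) :
    complexQuadraticChar F (negFourInv hF t) =
      complexQuadraticChar F (-1) * complexQuadraticChar F t := by
  rw [negFourInv_apply, neg_eq_neg_one_mul, map_mul, complexQuadraticChar_inv_apply, map_mul,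
    complexQuadraticChar_four hF, one_mul]

section CardThreeModFour

variable [DecidableEq F] (hF : ringChar F ≠ 2) (hq : Fintype.card F % 4 = 3)
  {ψ : AddChar F ℂ} (hψ : ψ.IsPrimitive) {k : ℕ} (hk : Even k)

include hF hq

theorem complexQuadraticChar_neg_one : complexQuadraticChar F (-1) = -1 := by
  rw [complexQuadraticChar_apply, quadraticChar_neg_one hF, ZMod.χ₄_nat_three_mod_four hq]
  simp

include hψ hk

theorem gaussSum_pow_of_even :
    gaussSum (complexQuadraticChar F) ψ ^ (2 * k + 2) = -(Fintype.card F : ℂ) ^ (k + 1) := by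
  rw [show 2 * k + 2 = 2 * (k + 1) by ring, pow_mul,
    gaussSum_sq (complexQuadraticChar_ne_one hF) complexQuadraticChar_isQuadratic hψ,
    complexQuadraticChar_neg_one hF hq, neg_one_mul, hk.add_one.neg_pow]

theorem sum_addChar_normSq_of_even {t : F} (ht : t ≠ 0) (z : Fin (2 * k + 2) → F) :
    ∑ m : Fin (2 * k + 2) → F, ψ (t * normSq m) * ψ (m ⬝ᵥ z) =
      -(Fintype.card F : ℂ) ^ (k + 1) * ψ (negFourInv hF t * normSq z) := by
  rw [sum_addChar_normSq hF hψ ht, mul_pow, gaussSum_pow_of_even hF hq hψ hk, negFourInv_apply]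
  have h : complexQuadraticChar F t ^ (2 * k + 2) = 1 := by
    rw [show 2 * k + 2 = 2 * (k + 1) by ring, pow_mul, complexQuadraticChar_apply]
    have := quadraticChar_sq_one ht
    rw [← Int.cast_pow, this]
    simp
  rw [h, one_mul]

theorem sum_complexQuadraticChar_normSq (z : Fin (2 * k + 2) → F) :
    ∑ m : Fin (2 * k + 2) → F, complexQuadraticChar F (normSq m) * ψ (m ⬝ᵥ z) =
      (Fintype.card F : ℂ) ^ (k + 1) * complexQuadraticChar F (normSq z) := by
  have hG : gaussSum (complexQuadraticChar F) ψ ≠ 0 :=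
    gaussSum_ne_zero_of_nontrivial (Nat.cast_ne_zero.mpr Fintype.card_ne_zero)
      (complexQuadraticChar_ne_one hF) hψ
  apply mul_left_cancel₀ hG
  calc gaussSum (complexQuadraticChar F) ψ *
        ∑ m : Fin (2 * k + 2) → F, complexQuadraticChar F (normSq m) * ψ (m ⬝ᵥ z)
      = ∑ m : Fin (2 * k + 2) → F,
          (∑ t, complexQuadraticChar F t * ψ (t * normSq m)) * ψ (m ⬝ᵥ z) := by
        rw [Finset.mul_sum]
        refine Finset.sum_congr rfl fun m _ ↦ ?_
        rw [sum_complexQuadraticChar_mul_addChar hF ψ]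
        ring
    _ = ∑ t, complexQuadraticChar F t *
          ∑ m : Fin (2 * k + 2) → F, ψ (t * normSq m) * ψ (m ⬝ᵥ z) := by
        simp only [Finset.sum_mul, Finset.mul_sum, mul_assoc]
        exact Finset.sum_comm
    _ = ∑ t, (Fintype.card F : ℂ) ^ (k + 1) *
          (complexQuadraticChar F (negFourInv hF t) * ψ (negFourInv hF t * normSq z)) := by
        refine Finset.sum_congr rfl fun t _ ↦ ?_
        rw [complexQuadraticChar_negFourInv, complexQuadraticChar_neg_one hF hq]
        rcases eq_or_ne t 0 with rfl | ht
        · simp [MulChar.map_zero]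
        · rw [sum_addChar_normSq_of_even hF hq hψ hk ht]
          ring
    _ = (Fintype.card F : ℂ) ^ (k + 1) *
          ∑ t, complexQuadraticChar F t * ψ (t * normSq z) := by
        rw [← Finset.mul_sum, Equiv.sum_comp (negFourInv hF)
          (fun t ↦ complexQuadraticChar F t * ψ (t * normSq z))]
    _ = _ := by
        rw [sum_complexQuadraticChar_mul_addChar hF ψ]
        ring

theorem sum_normSq_eq_zero (z : Fin (2 * k + 2) → F) :
    ∑ m : Fin (2 * k + 2) → F, (if normSq m = 0 then 1 else 0) * ψ (m ⬝ᵥ z) =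
      (if z = 0 then (Fintype.card F : ℂ) ^ (2 * k + 1) else 0)
        - (Fintype.card F : ℂ) ^ (k + 1) * (if normSq z = 0 then 1 else 0)
        + (Fintype.card F : ℂ) ^ k := by
  have hq0 : (Fintype.card F : ℂ) ≠ 0 := Nat.cast_ne_zero.mpr Fintype.card_ne_zero
  have hind (a : F) : ∑ t, ψ (t * a) = Fintype.card F * (if a = 0 then 1 else 0) := by
    rw [AddChar.sum_mulShift a hψ]; split_ifs <;> simp
  apply mul_left_cancel₀ hq0
  calc (Fintype.card F : ℂ) *
        ∑ m : Fin (2 * k + 2) → F, (if normSq m = 0 then 1 else 0) * ψ (m ⬝ᵥ z)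
      = ∑ t, ∑ m : Fin (2 * k + 2) → F, ψ (t * normSq m) * ψ (m ⬝ᵥ z) := by
        rw [Finset.sum_comm, Finset.mul_sum]
        refine Finset.sum_congr rfl fun m _ ↦ ?_
        rw [← Finset.sum_mul, hind]
        ring
    _ = ∑ t, ((if t = 0 then ∑ m : Fin (2 * k + 2) → F, ψ (m ⬝ᵥ z)
            + (Fintype.card F : ℂ) ^ (k + 1) else 0)
          - (Fintype.card F : ℂ) ^ (k + 1) * ψ (negFourInv hF t * normSq z)) := by
        refine Finset.sum_congr rfl fun t _ ↦ ?_
        rcases eq_or_ne t 0 with rfl | ht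
        · simp [negFourInv_apply]
        · rw [sum_addChar_normSq_of_even hF hq hψ hk ht, if_neg ht]
          ring
    _ = ∑ m : Fin (2 * k + 2) → F, ψ (m ⬝ᵥ z) + (Fintype.card F : ℂ) ^ (k + 1)
          - (Fintype.card F : ℂ) ^ (k + 1) * ∑ t, ψ (t * normSq z) := by
        rw [Finset.sum_sub_distrib, ← Finset.mul_sum, Equiv.sum_comp (negFourInv hF)
          (fun t ↦ ψ (t * normSq z)), Finset.sum_ite_eq' univ (0 : F), if_pos (Finset.mem_univ _)]
    _ = _ := by
        rw [hind, sum_addChar_dotProduct hψ]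
        split_ifs <;> ring

end CardThreeModFour

/-- The Fourier transform of `z ↦ η(‖z‖) + 1_{‖z‖ = 0}` on `F ^ (2k+2)`, when `k` is even and
`|F| ≡ 3 mod 4`. -/
noncomputable def squareKernelTransform [DecidableEq F] (k : ℕ) (m : Fin (2 * k + 2) → F) : ℝ :=
  (if m = 0 then (Fintype.card F : ℝ) ^ (2 * k + 1) else 0) + (Fintype.card F : ℝ) ^ k
    - (Fintype.card F : ℝ) ^ (k + 1) * (if normSq m = 0 then 1 else 0)
    + (Fintype.card F : ℝ) ^ (k + 1) * quadraticChar F (normSq m)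

theorem sum_squareKernelTransform [DecidableEq F] (hF : ringChar F ≠ 2)
    (hq : Fintype.card F % 4 = 3) {ψ : AddChar F ℂ} (hψ : ψ.IsPrimitive) {k : ℕ} (hk : Even k)
    (z : Fin (2 * k + 2) → F) :
    ∑ m, (squareKernelTransform k m : ℂ) * ψ (m ⬝ᵥ z) =
      (Fintype.card F : ℂ) ^ (2 * k + 2) *
        (quadraticChar F (normSq z) + if normSq z = 0 then 1 else 0) := by
  have hterm (m : Fin (2 * k + 2) → F) :
      (squareKernelTransform k m : ℂ) * ψ (m ⬝ᵥ z) =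
        (if m = 0 then (Fintype.card F : ℂ) ^ (2 * k + 1) else 0)
        + (Fintype.card F : ℂ) ^ k * ψ (m ⬝ᵥ z)
        - (Fintype.card F : ℂ) ^ (k + 1) * ((if normSq m = 0 then 1 else 0) * ψ (m ⬝ᵥ z))
        + (Fintype.card F : ℂ) ^ (k + 1) *
          (complexQuadraticChar F (normSq m) * ψ (m ⬝ᵥ z)) := by
    rw [complexQuadraticChar_apply, squareKernelTransform]
    rcases eq_or_ne m 0 with rfl | hm
    · by_cases h0 : normSq (0 : Fin (2 * k + 2) → F) = 0 <;> simp [h0]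
    · by_cases h0 : normSq m = 0 <;> simp only [if_neg hm, h0, if_true, if_false] <;>
        push_cast <;> ring
  simp only [hterm, Finset.sum_add_distrib, Finset.sum_sub_distrib, ← Finset.mul_sum]
  rw [sum_complexQuadraticChar_normSq hF hq hψ hk, sum_normSq_eq_zero hF hq hψ hk,
    sum_addChar_dotProduct hψ, Finset.sum_ite_eq' univ, if_pos (Finset.mem_univ _),
    complexQuadraticChar_apply]
  split_ifs <;> ring

theorem squareKernelTransform_le [DecidableEq F] (k : ℕ) (m : Fin (2 * k + 2) → F) :
    squareKernelTransform k m ≤ (Fintype.card F : ℝ) ^ (k + 1) + (Fintype.card F : ℝ) ^ k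
      + if m = 0 then (Fintype.card F : ℝ) ^ (2 * k + 1) - 2 * (Fintype.card F : ℝ) ^ (k + 1)
        else 0 := by
  have hpos : (0 : ℝ) ≤ (Fintype.card F : ℝ) ^ (k + 1) := by positivity
  unfold squareKernelTransform
  rcases eq_or_ne m 0 with rfl | hm
  · have h0 : normSq (0 : Fin (2 * k + 2) → F) = 0 := by simp [normSq]
    simp only [h0, quadraticChar_zero, if_true]
    push_cast
    linarith
  · simp only [if_neg hm]
    rcases eq_or_ne (normSq m) 0 with h0 | h0
    · simp only [h0, quadraticChar_zero, if_true]
      push_cast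
      linarith
    · rcases quadraticChar_dichotomy h0 with h | h <;> rw [h, if_neg h0] <;> push_cast <;> linarith

theorem sum_sum_addChar_dotProduct_sub {d : ℕ} (ψ : AddChar F ℂ) (A : Finset (Fin d → F))
    (h : (Fin d → F) → ℝ) :
    ∑ p ∈ A ×ˢ A, ∑ m, (h m : ℂ) * ψ (m ⬝ᵥ (p.1 - p.2)) =
      ((∑ m, h m * ‖∑ x ∈ A, ψ (m ⬝ᵥ x)‖ ^ 2 : ℝ) : ℂ) := by
  rw [Finset.sum_comm]
  push_cast
  refine Finset.sum_congr rfl fun m _ ↦ ?_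
  rw [← Finset.mul_sum, ← Complex.mul_conj', map_sum, Finset.sum_mul_sum, ← Finset.sum_product']
  congr 1
  refine Finset.sum_congr rfl fun p _ ↦ ?_
  rw [dotProduct_sub, sub_eq_add_neg, AddChar.map_add_eq_mul, AddChar.map_neg_eq_conj]

theorem sum_norm_sq_sum_addChar [DecidableEq F] {d : ℕ} {ψ : AddChar F ℂ} (hψ : ψ.IsPrimitive)
    (A : Finset (Fin d → F)) :
    ∑ m : Fin d → F, ‖∑ x ∈ A, ψ (m ⬝ᵥ x)‖ ^ 2 = (Fintype.card F : ℝ) ^ d * #A := by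
  have h := sum_sum_addChar_dotProduct_sub ψ A (fun _ ↦ 1)
  simp only [Complex.ofReal_one, one_mul, sum_addChar_dotProduct hψ, sub_eq_zero] at h
  rw [Finset.sum_product] at h
  simp only [Finset.sum_ite_eq] at h
  rw [Finset.sum_congr rfl (fun x hx ↦ if_pos hx), Finset.sum_const, nsmul_eq_mul] at h
  apply Complex.ofReal_injective
  rw [← h]
  push_cast
  ring

end FourierTransform

theorem two_mul_SQpairs_add_ZRpairs {d : ℕ} {F : Type} [Field F] [Fintype F] [DecidableEq F]
    (A : Finset (Fin d → F)) :
    2 * ((SQpairs A : ℝ) + ZRpairs A) = (#A : ℝ) ^ 2 +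
      ∑ p ∈ A ×ˢ A, ((quadraticChar F (normSq (p.1 - p.2)) : ℝ) +
        if normSq (p.1 - p.2) = 0 then 1 else 0) := by
  have hcard : (#A : ℝ) ^ 2 = ∑ _p ∈ A ×ˢ A, (1 : ℝ) := by
    simp [Finset.card_product, sq]
  rw [hcard, ← Finset.sum_add_distrib, SQpairs, ZRpairs, Finset.natCast_card_filter,
    Finset.natCast_card_filter, ← Finset.sum_add_distrib, Finset.mul_sum]
  refine Finset.sum_congr rfl fun p _ ↦ ?_
  rcases eq_or_ne (normSq (p.1 - p.2)) 0 with h0 | h0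
  · simp only [h0, quadraticChar_zero]
    norm_num
  · rcases quadraticChar_dichotomy h0 with h | h <;> rw [h] <;> norm_num [h0]

theorem sum_quadraticChar_normSq_sub_le {F : Type} [Field F] [Fintype F] [DecidableEq F]
    (hF : ringChar F ≠ 2) (hq : Fintype.card F % 4 = 3) {k : ℕ} (hk : Even k)
    (A : Finset (Fin (2 * k + 2) → F)) :
    (Fintype.card F : ℝ) ^ (2 * k + 2) *
        ∑ p ∈ A ×ˢ A, ((quadraticChar F (normSq (p.1 - p.2)) : ℝ) +
          if normSq (p.1 - p.2) = 0 then 1 else 0) ≤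
      ((Fintype.card F : ℝ) ^ (k + 1) + (Fintype.card F : ℝ) ^ k) *
          ((Fintype.card F : ℝ) ^ (2 * k + 2) * #A)
        + ((Fintype.card F : ℝ) ^ (2 * k + 1) - 2 * (Fintype.card F : ℝ) ^ (k + 1)) *
          (#A : ℝ) ^ 2 := by
  let ψ := AddChar.FiniteField.primitiveChar_to_Complex F
  have hψ : ψ.IsPrimitive := AddChar.FiniteField.primitiveChar_to_Complex_isPrimitive F
  have h := sum_sum_addChar_dotProduct_sub ψ A (squareKernelTransform k)
  simp only [sum_squareKernelTransform hF hq hψ hk] at h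
  rw [← Finset.mul_sum] at h
  have h' : (Fintype.card F : ℝ) ^ (2 * k + 2) *
        ∑ p ∈ A ×ˢ A, ((quadraticChar F (normSq (p.1 - p.2)) : ℝ) +
          if normSq (p.1 - p.2) = 0 then 1 else 0) =
      ∑ m, squareKernelTransform k m * ‖∑ x ∈ A, ψ (m ⬝ᵥ x)‖ ^ 2 := by
    apply Complex.ofReal_injective
    rw [← h]
    push_cast [apply_ite Complex.ofReal]
    rfl
  rw [h', ← sum_norm_sq_sum_addChar hψ A]
  calc ∑ m, squareKernelTransform k m * ‖∑ x ∈ A, ψ (m ⬝ᵥ x)‖ ^ 2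
      ≤ ∑ m, ((Fintype.card F : ℝ) ^ (k + 1) + (Fintype.card F : ℝ) ^ k
          + if m = 0 then (Fintype.card F : ℝ) ^ (2 * k + 1) - 2 * (Fintype.card F : ℝ) ^ (k + 1)
            else 0) * ‖∑ x ∈ A, ψ (m ⬝ᵥ x)‖ ^ 2 :=
        Finset.sum_le_sum fun m _ ↦
          mul_le_mul_of_nonneg_right (squareKernelTransform_le k m) (by positivity)
    _ = _ := by
        simp only [add_mul _ (ite _ _ _), Finset.sum_add_distrib, ← Finset.mul_sum, ite_mul,
          zero_mul, Finset.sum_ite_eq', Finset.mem_univ, if_true]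
        simp

theorem distance_structure_d2q3 (q d : ℕ) (F : Type) [Field F] [Fintype F] [DecidableEq F]
    (hcard : Fintype.card F = q) (hodd : Odd q)
    (hd : d % 4 = 2) (hq : q % 4 = 3) (hd2 : 2 ≤ d)
    (A : Finset (Fin d → F)) :
    (SQpairs A : ℝ) + (ZRpairs A : ℝ) ≤ (A.card : ℝ) ^ 2 / 2 + (A.card : ℝ) ^ 2 / (2 * q)
      - (A.card : ℝ) ^ 2 / (q : ℝ) ^ (d / 2) + (q : ℝ) ^ (d / 2) * (A.card : ℝ) / 2
      + (q : ℝ) ^ ((d - 2) / 2) * (A.card : ℝ) / 2 := by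
  subst hcard
  obtain ⟨k, rfl⟩ : ∃ k, d = 2 * k + 2 := ⟨(d - 2) / 2, by omega⟩
  have hk : Even k := by rw [Nat.even_iff]; omega
  have hF : ringChar F ≠ 2 := fun h ↦ by
    have := FiniteField.even_card_of_char_two h
    omega
  have hq0 : (0 : ℝ) < Fintype.card F := Nat.cast_pos.mpr Fintype.card_pos
  have hpairs := two_mul_SQpairs_add_ZRpairs A
  have hbound := sum_quadraticChar_normSq_sub_le hF hq hk A
  rw [← le_div_iff₀' (by positivity)] at hbound
  have hsimp : (((Fintype.card F : ℝ) ^ (k + 1) + (Fintype.card F : ℝ) ^ k) *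
          ((Fintype.card F : ℝ) ^ (2 * k + 2) * #A)
        + ((Fintype.card F : ℝ) ^ (2 * k + 1) - 2 * (Fintype.card F : ℝ) ^ (k + 1)) *
          (#A : ℝ) ^ 2) / (Fintype.card F : ℝ) ^ (2 * k + 2) =
      2 * ((#A : ℝ) ^ 2 / (2 * Fintype.card F) - (#A : ℝ) ^ 2 / (Fintype.card F : ℝ) ^ (k + 1)
        + (Fintype.card F : ℝ) ^ (k + 1) * #A / 2 + (Fintype.card F : ℝ) ^ k * #A / 2) := by
    field_simp
    ring
  rw [hsimp] at hbound
  rw [show (2 * k + 2) / 2 = k + 1 by omega, show (2 * k + 2 - 2) / 2 = k by omega]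
  linarith
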